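/- arXiv:2307.05897 — 2 statements merged into one kernel-verified Lean document; each statement's English description precedes it below -/
import Mathlib

section
/- Let q ≥ 2 be an integer, D a strongly connected digraph with a vertex x, and Z₁, Z₂ ⊆ A(D) with μ(D,Z₁,Z₂) ≥ 3072 q². Then there exist vertex sets U ⊆ Y ⊆ V(D)∖{x}, a vertex w ∈ U, a directed path P of length at least 1 in D[Y], and r, s ∈ [q] such that: (1) D[U] and D[Y] are strongly connected; (2) V(P) ∩ U = {w} and w is the last vertex of P; (3) μ(D[U],Z₁,Z₂) ≥ μ(D,Z₁,Z₂)/2 − 1536; (4) the first arc of P lies in Z₁ Δ Z₂; and (5) for each of the first two vertices v of P there is a directed (x,v)-path Q in D[(V(D)∖Y) ∪ {v}] with |A(Q)∩Z₁| ≡ r (mod q) and |A(Q)∩Z₂| ≡ s (mod q). -/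
variable {V : Type}

/-- The arcs of a directed cycle given by its (cyclic) vertex list. -/
def cycleArcs (vs : List V) : List (V × V) := vs.zip (vs.rotate 1)

/-- The arcs of a directed path given by its vertex list. -/
def pathArcs (vs : List V) : List (V × V) := vs.zip vs.tail

/-- `vs` is the vertex list of a directed cycle in the digraph `D`. -/
def IsDicycle (D : V → V → Prop) (vs : List V) : Prop :=
  vs ≠ [] ∧ vs.Nodup ∧ ∀ p ∈ cycleArcs vs, D p.1 p.2

/-- The number of (distinct) arcs of `l` that lie in `Z`. -/
noncomputable def arcCount (l : List (V × V)) (Z : Set (V × V)) : ℕ :=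
  Nat.card {a : V × V // a ∈ l ∧ a ∈ Z}

/-- The directed cycle `vs` is `(Z1, Z2)`-unbalanced. -/
def Unbalanced (Z1 Z2 : Set (V × V)) (vs : List V) : Prop :=
  arcCount (cycleArcs vs) Z1 ≠ arcCount (cycleArcs vs) Z2

/-- The induced subdigraph `D[S]` contains no `(Z1,Z2)`-unbalanced directed cycle. -/
def NoUnbCycle (D : V → V → Prop) (Z1 Z2 : Set (V × V)) (S : Set V) : Prop :=
  ∀ vs : List V, IsDicycle D vs → (∀ v ∈ vs, v ∈ S) → ¬ Unbalanced Z1 Z2 vs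

/-- `mu D Z1 Z2 S` is the `(Z1,Z2)`-unbalanced dichromatic number of the induced
subdigraph `D[S]`: the least number of parts of a partition of `S` each of whose
parts induces no `(Z1,Z2)`-unbalanced directed cycle. -/
noncomputable def mu (D : V → V → Prop) (Z1 Z2 : Set (V × V)) (S : Set V) : ℕ :=
  sInf {k | ∃ c : V → Fin k, ∀ i : Fin k, NoUnbCycle D Z1 Z2 (S ∩ {v | c v = i})}

/-- The adjacency relation of the induced subdigraph `D[S]`. -/
def inducedRel (D : V → V → Prop) (S : Set V) : V → V → Prop :=
  fun u v => D u v ∧ u ∈ S ∧ v ∈ S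

/-- The induced subdigraph `D[S]` is strongly connected. -/
def StronglyConnectedOn (D : V → V → Prop) (S : Set V) : Prop :=
  ∀ u ∈ S, ∀ v ∈ S, Relation.ReflTransGen (inducedRel D S) u v

/-- `H` is (the vertex set of) a strong component of the induced subdigraph `D[S]`. -/
def IsStrongComponent (D : V → V → Prop) (S H : Set V) : Prop :=
  H ⊆ S ∧ H.Nonempty ∧ StronglyConnectedOn D H ∧
    ∀ H', H ⊆ H' → H' ⊆ S → StronglyConnectedOn D H' → H' = H

/-- `vs` is the vertex list of a directed path in `D`. -/
def IsDipath (D : V → V → Prop) (vs : List V) : Prop :=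
  vs.Nodup ∧ vs.Chain' D

/-- `vs` is a directed path in `D` from `x` to `y`. -/
def IsDipathFromTo (D : V → V → Prop) (vs : List V) (x y : V) : Prop :=
  IsDipath D vs ∧ vs.head? = some x ∧ vs.getLast? = some y

/-- The internal vertices of a path given by its vertex list. -/
def internalVerts (vs : List V) : List V := vs.tail.dropLast

/-- `vs` is a directed `X`-path in `D` from `x` to `y`: a directed path whose two
endpoints are distinct vertices of `X` and whose internal vertices avoid `X`. -/
def IsXPath (D : V → V → Prop) (X : Set V) (vs : List V) (x y : V) : Prop :=
  IsDipathFromTo D vs x y ∧ x ∈ X ∧ y ∈ X ∧ x ≠ y ∧ ∀ v ∈ internalVerts vs, v ∉ X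

lemma mem_of_mem_cycleArcs {vs : List V} {p : V × V} (hp : p ∈ cycleArcs vs) :
    p.1 ∈ vs ∧ p.2 ∈ vs := by
  have h := List.of_mem_zip (a := p.1) (b := p.2) hp
  exact ⟨h.1, List.mem_rotate.1 h.2⟩

lemma reflTransGen_of_cycleArcs {R : V → V → Prop} {vs : List V}
    (h : ∀ p ∈ cycleArcs vs, R p.1 p.2) {a b : V} (ha : a ∈ vs) (hb : b ∈ vs) :
    Relation.ReflTransGen R a b := by
  obtain ⟨i, hi, rfl⟩ := List.mem_iff_getElem.1 ha
  obtain ⟨j, hj, rfl⟩ := List.mem_iff_getElem.1 hb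
  have hn : 0 < vs.length := by omega
  have key : ∀ k, Relation.ReflTransGen R vs[i]
      (vs[(i + k) % vs.length]'(Nat.mod_lt _ hn)) := by
    intro k
    induction k with
    | zero => simp [Nat.mod_eq_of_lt hi, Relation.ReflTransGen.refl]
    | succ k ih =>
      refine ih.tail ?_
      have hm : (i + k) % vs.length < vs.length := Nat.mod_lt _ hn
      have := h (vs[(i + k) % vs.length], vs[(i + (k + 1)) % vs.length]'(Nat.mod_lt _ hn)) (by
        rw [cycleArcs, List.mem_iff_getElem]
        refine ⟨(i + k) % vs.length, by simpa using hm, ?_⟩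
        simp [List.getElem_zip, List.getElem_rotate, add_assoc])
      exact this
  have := key (j + vs.length - i)
  have e : (i + (j + vs.length - i)) % vs.length = j := by
    rw [show i + (j + vs.length - i) = j + vs.length by omega, Nat.add_mod_right,
      Nat.mod_eq_of_lt hj]
  simpa only [e] using this

lemma eq_of_monotone_cycleArcs {β : Type*} [PartialOrder β] {f : V → β} {vs : List V}
    (h : ∀ p ∈ cycleArcs vs, f p.1 ≤ f p.2) {a b : V} (ha : a ∈ vs) (hb : b ∈ vs) :
    f a = f b := by
  have key : ∀ {u v : V}, Relation.ReflTransGen (fun u v => f u ≤ f v) u v → f u ≤ f v := by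
    intro u v huv
    induction huv with
    | refl => exact le_rfl
    | tail _ h ih => exact ih.trans h
  exact le_antisymm (key (reflTransGen_of_cycleArcs h ha hb))
    (key (reflTransGen_of_cycleArcs h hb ha))

lemma exists_mem_symmDiff_of_unbalanced {Z1 Z2 : Set (V × V)} {vs : List V}
    (h : Unbalanced Z1 Z2 vs) : ∃ p ∈ cycleArcs vs, p ∈ (Z1 \ Z2) ∪ (Z2 \ Z1) := by
  by_contra! hc
  refine h ?_
  have : ∀ p, (p ∈ cycleArcs vs ∧ p ∈ Z1) ↔ (p ∈ cycleArcs vs ∧ p ∈ Z2) := by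
    intro p
    have := hc p
    simp only [Set.mem_union, Set.mem_sdiff] at this
    tauto
  simp only [arcCount, this]

lemma arcCount_singleton_eq_zero (p : V × V) (Z : Set (V × V)) :
    arcCount [p] Z = 0 ↔ p ∉ Z := by
  have : Finite {a : V × V // a ∈ [p] ∧ a ∈ Z} :=
    ((List.finite_toSet [p]).subset fun a h => h.1).to_subtype
  rw [arcCount, Finite.card_eq_zero_iff, isEmpty_subtype]
  simp

lemma NoUnbCycle.mono {D : V → V → Prop} {Z1 Z2 : Set (V × V)} {S T : Set V}
    (h : NoUnbCycle D Z1 Z2 T) (hST : S ⊆ T) : NoUnbCycle D Z1 Z2 S :=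
  fun vs hvs hS => h vs hvs fun v hv => hST (hS v hv)

lemma mu_le_of_coloring {D : V → V → Prop} {Z1 Z2 : Set (V × V)} {S : Set V} {ι : Type*}
    [Fintype ι] (c : V → ι) (h : ∀ i, NoUnbCycle D Z1 Z2 (S ∩ {v | c v = i})) :
    mu D Z1 Z2 S ≤ Fintype.card ι := by
  refine Nat.sInf_le ⟨fun v => Fintype.equivFin ι (c v), fun i =>
    (h ((Fintype.equivFin ι).symm i)).mono ?_⟩
  rintro v ⟨hv, hi⟩
  exact ⟨hv, by simpa [Equiv.eq_symm_apply] using hi⟩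

lemma noUnbCycle_singleton_of_mu_pos {D : V → V → Prop} {Z1 Z2 : Set (V × V)}
    (h : 0 < mu D Z1 Z2 Set.univ) (v : V) : NoUnbCycle D Z1 Z2 {v} := by
  obtain ⟨k, c, hc⟩ := Nat.nonempty_of_pos_sInf h
  exact (hc (c v)).mono (by simp)

lemma exists_coloring_of_mu_le [Fintype V] {D : V → V → Prop} {Z1 Z2 : Set (V × V)}
    (hl : ∀ v, NoUnbCycle D Z1 Z2 {v}) {S : Set V} {k : ℕ} (hk : mu D Z1 Z2 S ≤ k) :
    ∃ c : V → Fin k, ∀ i, NoUnbCycle D Z1 Z2 (S ∩ {v | c v = i}) := by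
  obtain ⟨c, hc⟩ := Nat.sInf_mem (s := {k | ∃ c : V → Fin k, ∀ i : Fin k,
      NoUnbCycle D Z1 Z2 (S ∩ {v | c v = i})})
    ⟨Fintype.card V, fun v => Fintype.equivFin V v, fun i =>
      (hl ((Fintype.equivFin V).symm i)).mono (by
        rintro v ⟨_, hv⟩
        simpa [Equiv.eq_symm_apply] using hv)⟩
  refine ⟨fun v => Fin.castLE hk (c v), fun i vs hvs hS => ?_⟩
  obtain ⟨a, ha⟩ := List.exists_mem_of_ne_nil vs hvs.1
  refine hc (c a) vs hvs fun v hv => ⟨(hS v hv).1, ?_⟩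
  have := (hS v hv).2.trans (hS a ha).2.symm
  exact Fin.castLE_injective hk this

lemma mu_le_one {D : V → V → Prop} {Z1 Z2 : Set (V × V)} {S : Set V}
    (h : NoUnbCycle D Z1 Z2 S) : mu D Z1 Z2 S ≤ 1 := by
  simpa using mu_le_of_coloring (fun _ => ()) fun _ => h.mono Set.inter_subset_left

lemma mu_mono [Fintype V] {D : V → V → Prop} {Z1 Z2 : Set (V × V)}
    (hl : ∀ v, NoUnbCycle D Z1 Z2 {v}) {S T : Set V} (h : S ⊆ T) :
    mu D Z1 Z2 S ≤ mu D Z1 Z2 T := by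
  obtain ⟨c, hc⟩ := exists_coloring_of_mu_le hl (le_refl (mu D Z1 Z2 T))
  simpa using mu_le_of_coloring c fun i => (hc i).mono (Set.inter_subset_inter_left _ h)

lemma mu_union_le [Fintype V] {D : V → V → Prop} {Z1 Z2 : Set (V × V)}
    (hl : ∀ v, NoUnbCycle D Z1 Z2 {v}) (S T : Set V) :
    mu D Z1 Z2 (S ∪ T) ≤ mu D Z1 Z2 S + mu D Z1 Z2 T := by
  classical
  obtain ⟨c, hc⟩ := exists_coloring_of_mu_le hl (le_refl (mu D Z1 Z2 S))
  obtain ⟨e, he⟩ := exists_coloring_of_mu_le hl (le_refl (mu D Z1 Z2 T))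
  have := mu_le_of_coloring (D := D) (Z1 := Z1) (Z2 := Z2) (S := S ∪ T)
    (fun v => if v ∈ S then Sum.inl (c v) else Sum.inr (e v)) (by
      rintro (i | i)
      · refine (hc i).mono ?_
        rintro v ⟨hv, hi⟩
        by_cases hS : v ∈ S <;> simp_all
      · refine (he i).mono ?_
        rintro v ⟨hv, hi⟩
        by_cases hS : v ∈ S <;> simp_all)
  simpa using this

/-- If `g` splits the vertices into classes such that `h` is constant on every directed cycle
inside a class, then it suffices to colour each joint fibre of `g` and `h` separately. -/
lemma mu_le_card_mul [Fintype V] {D : V → V → Prop} {Z1 Z2 : Set (V × V)}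
    (hl : ∀ v, NoUnbCycle D Z1 Z2 {v}) {S : Set V} {ι β : Type*} [Fintype ι] (g : V → ι)
    (h : V → β) (hcyc : ∀ vs, IsDicycle D vs → (∀ v ∈ vs, v ∈ S) →
      (∀ u ∈ vs, ∀ v ∈ vs, g u = g v) → ∀ u ∈ vs, ∀ v ∈ vs, h u = h v)
    {k : ℕ} (hk : ∀ i b, mu D Z1 Z2 (S ∩ {v | g v = i ∧ h v = b}) ≤ k) :
    mu D Z1 Z2 S ≤ Fintype.card ι * k := by
  choose c hc using fun i b => exists_coloring_of_mu_le hl (hk i b)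
  have := mu_le_of_coloring (D := D) (Z1 := Z1) (Z2 := Z2) (S := S)
    (fun v => (g v, c (g v) (h v) v)) (by
      rintro ⟨i, j⟩ vs hvs hS
      have hg : ∀ v ∈ vs, g v = i := fun v hv => congrArg Prod.fst (hS v hv).2
      have hh := hcyc vs hvs (fun v hv => (hS v hv).1)
        (fun u hu v hv => (hg u hu).trans (hg v hv).symm)
      obtain ⟨a, ha⟩ := List.exists_mem_of_ne_nil vs hvs.1
      refine hc i (h a) j vs hvs fun v hv =>
        ⟨⟨(hS v hv).1, hg v hv, hh v hv a ha⟩, ?_⟩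
      have h2 : c (g v) (h v) v = j := congrArg Prod.snd (hS v hv).2
      rwa [hg v hv, hh v hv a ha] at h2)
  simpa using this

lemma exists_subset_mu_eq [Fintype V] {D : V → V → Prop} {Z1 Z2 : Set (V × V)}
    (hl : ∀ v, NoUnbCycle D Z1 Z2 {v}) {n : ℕ} (hn : 2 ≤ n) (C : Set V)
    (hC : n ≤ mu D Z1 Z2 C) : ∃ B ⊆ C, mu D Z1 Z2 B = n := by
  induction C, C.toFinite using Set.Finite.induction_on with
  | empty =>
    have : NoUnbCycle D Z1 Z2 ∅ := fun vs hvs h => by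
      obtain ⟨a, ha⟩ := List.exists_mem_of_ne_nil vs hvs.1
      exact (h a ha).elim
    have := mu_le_one this
    omega
  | @insert a C _ _ ih =>
    by_cases h : n ≤ mu D Z1 Z2 C
    · obtain ⟨B, hB, e⟩ := ih h
      exact ⟨B, hB.trans (Set.subset_insert _ _), e⟩
    · refine ⟨_, subset_rfl, ?_⟩
      have h1 := mu_union_le hl {a} C
      have h2 := mu_le_one (hl a)
      rw [← Set.insert_eq] at h1
      omega

lemma exists_stronglyConnectedOn_mu_le [Fintype V] {D : V → V → Prop} {Z1 Z2 : Set (V × V)}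
    (hl : ∀ v, NoUnbCycle D Z1 Z2 {v}) (S : Set V) :
    ∃ T ⊆ S, StronglyConnectedOn D T ∧ mu D Z1 Z2 S ≤ mu D Z1 Z2 T := by
  by_contra! hc
  have hpos := hc ∅ (Set.empty_subset _) (fun u hu => hu.elim)
  let R := Relation.ReflTransGen (inducedRel D S)
  let h : V → Set V := fun v => {w | R v w ∧ R w v}
  have heq : ∀ {u v}, R u v → R v u → h u = h v := fun huv hvu => by
    ext w
    exact ⟨fun hw => ⟨hvu.trans hw.1, hw.2.trans huv⟩, fun hw => ⟨huv.trans hw.1, hw.2.trans hvu⟩⟩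
  have := mu_le_card_mul (Z1 := Z1) (Z2 := Z2) hl (S := S) (fun _ => ()) h
    (fun vs hvs hS _ u hu v hv => by
      have hR : ∀ p ∈ cycleArcs vs, inducedRel D S p.1 p.2 := fun p hp =>
        ⟨hvs.2.2 p hp, hS _ (mem_of_mem_cycleArcs hp).1, hS _ (mem_of_mem_cycleArcs hp).2⟩
      exact heq (reflTransGen_of_cycleArcs hR hu hv) (reflTransGen_of_cycleArcs hR hv hu))
    (k := mu D Z1 Z2 S - 1) (fun i b => by
      refine Nat.le_sub_one_of_lt (hc _ Set.inter_subset_left ?_)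
      rintro u ⟨huS, -, hu⟩ v ⟨-, -, hv⟩
      have hmem : v ∈ h u := by
        rw [hu, ← hv]
        exact ⟨.refl, .refl⟩
      have key : ∀ {w}, R u w → R w v → Relation.ReflTransGen
          (inducedRel D (S ∩ {v | (fun _ => ()) v = i ∧ h v = b})) w v := by
        intro w huw hwv
        induction hwv using Relation.ReflTransGen.head_induction_on with
        | refl => exact .refl
        | @head w y hwy hyv ih =>
          have huy : R u y := huw.tail hwy
          refine .head ⟨hwy.1, ⟨hwy.2.1, rfl, ?_⟩, hwy.2.2, rfl, ?_⟩ (ih huy)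
          · exact (heq (((Relation.ReflTransGen.head hwy hyv)).trans hmem.2) huw).trans hu
          · exact (heq (hyv.trans hmem.2) huy).trans hu
      exact key .refl hmem.1)
  simp only [Fintype.card_unit, one_mul] at this
  omega

/-- `v` is the end of a walk with `n` steps that starts in `A`. -/
def StepsTo (R : V → V → Prop) (A : Set V) : ℕ → V → Prop
  | 0, v => v ∈ A
  | n + 1, v => ∃ u, StepsTo R A n u ∧ R u v

lemma StepsTo.of_reflTransGen {R : V → V → Prop} {A : Set V} {a v : V} (ha : a ∈ A)
    (h : Relation.ReflTransGen R a v) : ∃ n, StepsTo R A n v := by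
  induction h with
  | refl => exact ⟨0, ha⟩
  | tail _ h ih =>
    obtain ⟨n, hn⟩ := ih
    exact ⟨n + 1, _, hn, h⟩

lemma StepsTo.exists_path {R : V → V → Prop} {A : Set V} {n : ℕ} {v : V}
    (h : StepsTo R A n v) (hmin : ∀ m < n, ¬ StepsTo R A m v) :
    ∃ (Q : List V) (a : V), Q.Nodup ∧ Q.IsChain R ∧ Q.head? = some a ∧ a ∈ A ∧
      Q.getLast? = some v ∧ (∀ y ∈ Q, y ∈ A → y = a) ∧
      ∀ y ∈ Q, y = v ∨ ∃ m < n, StepsTo R A m y := by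
  induction n generalizing v with
  | zero => exact ⟨[v], v, by simp, by simp, rfl, h, rfl, by simp, by simp⟩
  | succ n ih =>
    obtain ⟨u, hu, huv⟩ := h
    obtain ⟨Q, a, hnd, hch, hhd, haA, hlast, hQA, hQ⟩ :=
      ih hu fun m hm hmu => hmin (m + 1) (by omega) ⟨u, hmu, huv⟩
    have hlt : ∀ y ∈ Q, ∃ m < n + 1, StepsTo R A m y := fun y hy => by
      rcases hQ y hy with rfl | ⟨m, hm, hy⟩
      · exact ⟨n, by omega, hu⟩
      · exact ⟨m, by omega, hy⟩
    refine ⟨Q ++ [v], a, ?_, ?_, ?_, haA, by simp, ?_, ?_⟩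
    · rw [List.nodup_append]
      refine ⟨hnd, by simp, ?_⟩
      rintro y hy z hz rfl
      obtain ⟨m, hm, hy⟩ := hlt y hy
      rw [List.mem_singleton.1 hz] at hy
      exact hmin m hm hy
    · rw [List.isChain_append]
      refine ⟨hch, by simp, ?_⟩
      simp [hlast, huv]
    · simp [hhd]
    · intro y hy hyA
      rcases List.mem_append.1 hy with hy | hy
      · exact hQA y hy hyA
      · rw [List.mem_singleton.1 hy] at hyA
        exact (hmin 0 (by omega) hyA).elim
    · intro y hy
      rcases List.mem_append.1 hy with hy | hy
      · exact .inr (hlt y hy)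
      · exact .inl (List.mem_singleton.1 hy)

lemma isChain_inducedRel {D : V → V → Prop} {S : Set V} {l : List V} (h : l.IsChain D)
    (hS : ∀ v ∈ l, v ∈ S) : l.IsChain (inducedRel D S) := by
  induction l with
  | nil => simp
  | cons a l ih =>
    rw [List.isChain_cons] at h ⊢
    refine ⟨fun y hy => ⟨h.1 y hy, hS _ (by simp), hS _ ?_⟩,
      ih h.2 fun v hv => hS v (List.mem_cons_of_mem _ hv)⟩
    exact List.mem_cons_of_mem _ (List.mem_of_mem_head? hy)

lemma reach_or_stepsTo_lt {D : V → V → Prop} {U Y : Set V} {a b : V} (hab : a ≠ b) {n : ℕ}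
    (h : StepsTo (flip (inducedRel D Y)) U n a) :
    (∃ w ∈ U, Relation.ReflTransGen (inducedRel D (Y \ {b})) a w) ∨
      ∃ m < n, StepsTo (flip (inducedRel D Y)) U m b := by
  induction n generalizing a with
  | zero => exact .inl ⟨a, h, .refl⟩
  | succ n ih =>
    obtain ⟨c, hc, hac⟩ := h
    by_cases hcb : c = b
    · exact .inr ⟨n, by omega, hcb ▸ hc⟩
    · rcases ih hcb hc with ⟨w, hw, hr⟩ | ⟨m, hm, hb⟩
      · exact .inl ⟨w, hw, .head ⟨hac.1, ⟨hac.2.1, hab⟩, hac.2.2, hcb⟩ hr⟩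
      · exact .inr ⟨m, by omega, hb⟩

/-- If every arc `(a, b)` of `B` in the symmetric difference of `Z1` and `Z2` is such that `a`
separates `b` from `U`, then two colours suffice for `B`. -/
lemma mu_le_two_of_separating [Fintype V] {D : V → V → Prop} {Z1 Z2 : Set (V × V)}
    (hl : ∀ v, NoUnbCycle D Z1 Z2 {v}) {U Y B : Set V} (hY : StronglyConnectedOn D Y)
    (hUY : U ⊆ Y) (hU : U.Nonempty) (hBY : B ⊆ Y) (hBU : Disjoint B U)
    (hsep : ∀ a ∈ B, ∀ b ∈ B, a ≠ b → D a b → (a, b) ∈ (Z1 \ Z2) ∪ (Z2 \ Z1) →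
      ¬ ∃ w ∈ U, Relation.ReflTransGen (inducedRel D (Y \ {a})) b w) :
    mu D Z1 Z2 B ≤ 2 := by
  classical
  let dom : V → Set V := fun v =>
    {u | u ∈ B ∧ ¬ ∃ w ∈ U, Relation.ReflTransGen (inducedRel D (Y \ {u})) v w}
  have hself : ∀ u ∈ B, u ∈ dom u := by
    refine fun u hu => ⟨hu, ?_⟩
    rintro ⟨w, hw, hr⟩
    rcases hr.cases_head with rfl | ⟨c, hc, -⟩
    · exact hBU.le_bot ⟨hu, hw⟩
    · exact hc.2.1.2 rfl
  have hstep : ∀ a ∈ B, ∀ b ∈ B, D a b → dom a ⊆ insert a (dom b) := by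
    rintro a ha b hb hab u ⟨huB, hu⟩
    by_cases hua : u = a
    · exact .inl hua
    refine .inr ?_
    by_cases hub : u = b
    · exact hub ▸ hself u huB
    refine ⟨huB, ?_⟩
    rintro ⟨w, hw, hr⟩
    exact hu ⟨w, hw, .head ⟨hab, ⟨hBY ha, fun h => hua h.symm⟩, hBY hb, fun h => hub h.symm⟩ hr⟩
  have hanti : ∀ a ∈ B, ∀ b ∈ B, a ≠ b → a ∈ dom b → b ∈ dom a → False := by
    intro a ha b hb hab hadb hbda
    obtain ⟨w, hw⟩ := hU
    have hex : ∃ n, StepsTo (flip (inducedRel D Y)) U n a ∨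
        StepsTo (flip (inducedRel D Y)) U n b := by
      obtain ⟨n, hn⟩ := StepsTo.of_reflTransGen (R := flip (inducedRel D Y)) hw
        (Relation.reflTransGen_swap.2 (hY a (hBY ha) w (hUY hw)))
      exact ⟨n, .inl hn⟩
    rcases Nat.find_spec hex with h | h
    · rcases reach_or_stepsTo_lt hab h with h | ⟨m, hm, h⟩
      · exact hbda.2 h
      · exact Nat.find_min hex hm (.inr h)
    · rcases reach_or_stepsTo_lt hab.symm h with h | ⟨m, hm, h⟩
      · exact hadb.2 h
      · exact Nat.find_min hex hm (.inl h)
  let d : V → ℕ := fun v => (dom v).ncard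
  let g : V → Fin 2 := fun v => ⟨d v % 2, Nat.mod_lt _ two_pos⟩
  have hle : ∀ a ∈ B, ∀ b ∈ B, D a b → d a ≤ d b + 1 := fun a ha b hb hab =>
    (Set.ncard_le_ncard (hstep a ha b hb hab) (Set.toFinite _)).trans (Set.ncard_insert_le _ _)
  have hconst : ∀ vs, IsDicycle D vs → (∀ v ∈ vs, v ∈ B) →
      (∀ u ∈ vs, ∀ v ∈ vs, g u = g v) → ∀ u ∈ vs, ∀ v ∈ vs, d u = d v := by
    intro vs hvs hB hg u hu v hv
    refine eq_of_monotone_cycleArcs (f := d) (fun p hp => ?_) hu hv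
    have hm := mem_of_mem_cycleArcs hp
    have h1 := hle _ (hB _ hm.1) _ (hB _ hm.2) (hvs.2.2 p hp)
    have h2 : d p.1 % 2 = d p.2 % 2 := congrArg Fin.val (hg _ hm.1 _ hm.2)
    omega
  have := mu_le_card_mul (Z1 := Z1) (Z2 := Z2) hl g d hconst (k := 1) (fun i n => by
    refine mu_le_one fun vs hvs hS hunb => ?_
    obtain ⟨⟨a, b⟩, hp, hZ⟩ := exists_mem_symmDiff_of_unbalanced hunb
    obtain ⟨ha, hb⟩ := mem_of_mem_cycleArcs hp
    have haB := (hS a ha).1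
    have hbB := (hS b hb).1
    have hD : D a b := hvs.2.2 _ hp
    by_cases hab : a = b
    · subst hab
      refine hl a [a] ⟨by simp, by simp, by simpa [cycleArcs] using hD⟩ (by simp) ?_
      intro heq
      have heq' : arcCount [(a, a)] Z1 = arcCount [(a, a)] Z2 := by simpa [cycleArcs] using heq
      have h : (a, a) ∉ Z1 ↔ (a, a) ∉ Z2 := by
        rw [← arcCount_singleton_eq_zero, heq', arcCount_singleton_eq_zero]
      rcases hZ with hZ | hZ
      · exact h.2 hZ.2 hZ.1
      · exact h.1 hZ.2 hZ.1
    · have hadb : a ∈ dom b := ⟨haB, hsep a haB b hbB hab hD hZ⟩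
      have hsub : dom a ⊆ dom b := fun u hu => by
        rcases hstep a haB b hbB hD hu with rfl | h
        · exact hadb
        · exact h
      have heq := Set.eq_of_subset_of_ncard_le hsub
        (le_of_eq ((hS b hb).2.2.trans (hS a ha).2.2.symm)) (Set.toFinite _)
      exact hanti a haB b hbB hab hadb (heq ▸ hself b hbB))
  simpa using this

/-- (Lemma 3.5 of the paper.) -/
theorem stmt10 [Fintype V] (q : ℕ) (hq : 2 ≤ q) (D : V → V → Prop) (x : V)
    (Z1 Z2 : Set (V × V)) (hsc : StronglyConnectedOn D Set.univ)
    (hmu : 3072 * q ^ 2 ≤ mu D Z1 Z2 Set.univ) :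
    ∃ (U Y : Set V) (w : V) (P : List V) (r s : ℕ),
      U ⊆ Y ∧ Y ⊆ Set.univ \ {x} ∧ w ∈ U ∧
      1 ≤ r ∧ r ≤ q ∧ 1 ≤ s ∧ s ≤ q ∧
      -- (1) D[U] and D[Y] are strongly connected
      StronglyConnectedOn D U ∧ StronglyConnectedOn D Y ∧
      -- P is a directed path in D[Y] of length at least 1
      IsDipath (inducedRel D Y) P ∧ 2 ≤ P.length ∧
      -- (2) V(P) ∩ U = {w} and w is the last vertex of P
      {v | v ∈ P} ∩ U = {w} ∧ P.getLast? = some w ∧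
      -- (3) μ(D[U],Z₁,Z₂) ≥ μ(D,Z₁,Z₂)/2 − 1536
      mu D Z1 Z2 Set.univ ≤ 2 * mu D Z1 Z2 U + 3072 ∧
      -- (4) the first arc of P is in Z₁ Δ Z₂
      (∃ p, (pathArcs P).head? = some p ∧ p ∈ (Z1 \ Z2) ∪ (Z2 \ Z1)) ∧
      -- (5) for each of the first two vertices v of P, there is an (x,v)-path Q in
      -- D[(V(D) \ Y) ∪ {v}] with |A(Q)∩Z₁| ≡ r and |A(Q)∩Z₂| ≡ s (mod q)
      ∀ v : V, P.head? = some v ∨ P[1]? = some v →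
        ∃ Q : List V, IsDipathFromTo (inducedRel D ((Set.univ \ Y) ∪ {v})) Q x v ∧
          (arcCount (pathArcs Q) Z1 : ℤ) ≡ (r : ℤ) [ZMOD (q : ℤ)] ∧
          (arcCount (pathArcs Q) Z2 : ℤ) ≡ (s : ℤ) [ZMOD (q : ℤ)] := by
  classical
  have hqq : 0 < q ^ 2 := by positivity
  have hl : ∀ v, NoUnbCycle D Z1 Z2 {v} := noUnbCycle_singleton_of_mu_pos (by omega)
  have hex : ∀ v, ∃ n, StepsTo D {x} n v := fun v => by
    refine StepsTo.of_reflTransGen (a := x) rfl ?_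
    exact Relation.ReflTransGen.mono (fun a b h => h.1) _ _ (hsc x trivial v trivial)
  let d : V → ℕ := fun v => Nat.find (hex v)
  have hdle : ∀ {m v}, StepsTo D {x} m v → d v ≤ m := fun h => Nat.find_min' _ h
  have hdarc : ∀ a b, D a b → d b ≤ d a + 1 := fun a b hab =>
    hdle ⟨a, Nat.find_spec (hex a), hab⟩
  have hpath : ∀ v, ∃ Q : List V, IsDipathFromTo D Q x v ∧ ∀ y ∈ Q, y = v ∨ d y < d v := by
    intro v
    obtain ⟨Q, a, hnd, hch, hhd, rfl, hlast, -, hQ⟩ :=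
      (Nat.find_spec (hex v)).exists_path fun m hm => Nat.find_min (hex v) hm
    refine ⟨Q, ⟨⟨hnd, hch⟩, hhd, hlast⟩, fun y hy => (hQ y hy).imp_right ?_⟩
    rintro ⟨m, hm, h⟩
    exact (hdle h).trans_lt hm
  choose Q hQ hQd using hpath
  -- a large layer of the breadth-first search from `x`
  obtain ⟨n, hn⟩ : ∃ n, mu D Z1 Z2 Set.univ ≤ 2 * mu D Z1 Z2 {v | d v = n} := by
    by_contra! hc
    have := mu_le_card_mul (Z1 := Z1) (Z2 := Z2) hl (S := Set.univ)
      (fun v => (⟨d v % 2, Nat.mod_lt _ two_pos⟩ : Fin 2)) d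
      (fun vs hvs _ hg u hu v hv => by
        refine OrderDual.toDual.injective (eq_of_monotone_cycleArcs
          (f := fun v => OrderDual.toDual (d v)) (fun p hp => ?_) hu hv)
        have hm := mem_of_mem_cycleArcs hp
        have h1 := hdarc _ _ (hvs.2.2 p hp)
        have h2 : d p.1 % 2 = d p.2 % 2 := congrArg Fin.val (hg _ hm.1 _ hm.2)
        refine OrderDual.toDual_le_toDual.2 ?_
        omega)
      (k := (mu D Z1 Z2 Set.univ - 1) / 2) (fun i n => by
        have h1 := hc n
        have h2 := mu_mono (Z1 := Z1) (Z2 := Z2) hl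
          (show Set.univ ∩ {v | (⟨d v % 2, Nat.mod_lt _ two_pos⟩ : Fin 2) = i ∧ d v = n} ⊆
            {v | d v = n} from fun v hv => hv.2.2)
        omega)
    simp only [Fintype.card_fin] at this
    omega
  obtain ⟨Y, hYn, hYs, hYmu⟩ :=
    exists_stronglyConnectedOn_mu_le (Z1 := Z1) (Z2 := Z2) hl {v | d v = n}
  have hxY : x ∉ Y := by
    intro hx
    have hd0 : d x = 0 := Nat.le_zero.1 (hdle (m := 0) rfl)
    have hn0 : n = 0 := (hYn hx).symm.trans hd0
    have : {v | d v = n} ⊆ {x} := fun v hv => by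
      have h : StepsTo D {x} (d v) v := Nat.find_spec (hex v)
      rw [show d v = 0 from (show d v = n from hv).trans hn0] at h
      exact h
    have := mu_le_one ((hl x).mono this)
    omega
  have hq0 : 0 < q := by omega
  -- a large part of `Y` on which the residues of the paths from `x` are constant
  let g : V → Fin q × Fin q := fun v =>
    (⟨arcCount (pathArcs (Q v)) Z1 % q, Nat.mod_lt _ hq0⟩,
      ⟨arcCount (pathArcs (Q v)) Z2 % q, Nat.mod_lt _ hq0⟩)
  obtain ⟨i, hi⟩ : ∃ i, 3 ≤ mu D Z1 Z2 (Y ∩ {v | g v = i}) := by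
    by_contra! hc
    have := mu_le_card_mul (Z1 := Z1) (Z2 := Z2) hl (S := Y) g (fun _ => ())
      (fun _ _ _ _ _ _ _ _ => rfl) (k := 2) (fun i b => by
        have := hc i
        simp only [and_true]
        omega)
    simp only [Fintype.card_prod, Fintype.card_fin, ← sq] at this
    omega
  obtain ⟨B, hB, hBmu⟩ := exists_subset_mu_eq hl (by omega) _ hi
  obtain ⟨U, hUsub, hUs, hUmu⟩ :=
    exists_stronglyConnectedOn_mu_le (Z1 := Z1) (Z2 := Z2) hl (Y \ B)
  have hYB : mu D Z1 Z2 Y ≤ mu D Z1 Z2 U + 3 := by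
    have h1 := mu_union_le (Z1 := Z1) (Z2 := Z2) hl (Y \ B) B
    have h2 := mu_mono (Z1 := Z1) (Z2 := Z2) hl
      (show Y ⊆ Y \ B ∪ B from fun v hv => by by_cases h : v ∈ B <;> simp [h, hv])
    omega
  have hUY : U ⊆ Y := fun v hv => (hUsub hv).1
  have hUne : U.Nonempty := by
    rw [Set.nonempty_iff_ne_empty]
    rintro rfl
    have := mu_le_one ((hl x).mono (Set.empty_subset _))
    omega
  have hBY : B ⊆ Y := fun v hv => (hB hv).1
  obtain ⟨a, haB, b, hbB, hab, hDab, hZ, w', hw', hr⟩ : ∃ a ∈ B, ∃ b ∈ B, a ≠ b ∧ D a b ∧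
      (a, b) ∈ (Z1 \ Z2) ∪ (Z2 \ Z1) ∧
      ∃ w ∈ U, Relation.ReflTransGen (inducedRel D (Y \ {a})) b w := by
    by_contra hc
    have := mu_le_two_of_separating (Z1 := Z1) (Z2 := Z2) hl hYs hUY hUne hBY
      (Set.disjoint_left.2 fun v hv hU => (hUsub hU).2 hv)
      (fun a ha b hb hab hD hZ hr => hc ⟨a, ha, b, hb, hab, hD, hZ, hr⟩)
    omega
  -- a path from `b` to `U` in `Y` that avoids `a`
  obtain ⟨P, w, hwU, hPnd, hPch, hPhd, hPlast, hPU, hPY⟩ : ∃ (P : List V) (w : V), w ∈ U ∧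
      P.Nodup ∧ P.IsChain D ∧ P.head? = some b ∧ P.getLast? = some w ∧
      (∀ y ∈ P, y ∈ U → y = w) ∧ ∀ y ∈ P, y ∈ Y \ {a} := by
    have hex' := StepsTo.of_reflTransGen (R := flip (inducedRel D (Y \ {a}))) hw'
      (Relation.reflTransGen_swap.2 hr)
    obtain ⟨P, w, hnd, hch, hhd, hwU, hlast, hPU, hP⟩ :=
      (Nat.find_spec hex').exists_path fun m hm => Nat.find_min hex' hm
    refine ⟨P.reverse, w, hwU, by simpa using hnd, ?_, by simpa using hlast,
      by simpa using hhd, by simpa using hPU, ?_⟩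
    · rw [List.isChain_reverse]
      exact hch.imp fun u v h => h.1
    · intro y hy
      rcases hP y (by simpa using hy) with rfl | ⟨m, -, hm⟩
      · exact ⟨hBY hbB, hab.symm⟩
      · cases m with
        | zero => exact ⟨hUY hm, fun h => (hUsub hm).2 ((show y = a from h) ▸ haB)⟩
        | succ m =>
          obtain ⟨u, -, hu⟩ := hm
          exact hu.2.1
  obtain ⟨P, rfl⟩ : ∃ P', P = b :: P' := by
    cases P with
    | nil => simp at hPhd
    | cons c P => exact ⟨P, by simpa using hPhd⟩
  have hres : ∀ k : Fin q, ∃ r : ℕ, 1 ≤ r ∧ r ≤ q ∧ r ≡ k [MOD q] := fun k => by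
    by_cases hk : (k : ℕ) = 0
    · exact ⟨q, by omega, le_rfl, by simp [hk, Nat.ModEq]⟩
    · exact ⟨k, by omega, k.2.le, rfl⟩
  obtain ⟨r, hr1, hrq, hr'⟩ := hres i.1
  obtain ⟨s, hs1, hsq, hs'⟩ := hres i.2
  refine ⟨U, Y, w, a :: b :: P, r, s, hUY, fun v hv => ⟨trivial, ?_⟩, hwU, hr1, hrq, hs1, hsq,
    hUs, hYs, ⟨?_, ?_⟩, by simp, ?_, by simpa using hPlast, by omega,
    ⟨(a, b), by simp [pathArcs], hZ⟩, ?_⟩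
  · rintro rfl
    exact hxY hv
  · exact List.nodup_cons.2 ⟨fun h => (hPY a h).2 rfl, hPnd⟩
  · refine isChain_inducedRel ?_ ?_
    · exact List.isChain_cons.2 ⟨by simpa using hDab, hPch⟩
    · intro v hv
      rcases List.mem_cons.1 hv with rfl | hv
      · exact hBY haB
      · exact (hPY v hv).1
  · ext v
    constructor
    · rintro ⟨hv, hvU⟩
      rcases List.mem_cons.1 hv with rfl | hv
      · exact ((hUsub hvU).2 haB).elim
      · exact hPU v hv hvU
    · rintro rfl
      exact ⟨List.mem_cons_of_mem _ (List.mem_of_getLast? hPlast), hwU⟩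
  · intro v hv
    have hvB : v ∈ B := by
      rcases hv with hv | hv
      · simp only [List.head?_cons, Option.some.injEq] at hv
        exact hv ▸ haB
      · simp only [List.getElem?_cons_succ, List.getElem?_cons_zero, Option.some.injEq] at hv
        exact hv ▸ hbB
    have hgv : g v = i := (hB hvB).2
    refine ⟨Q v, ⟨⟨(hQ v).1.1, isChain_inducedRel (hQ v).1.2 fun y hy => ?_⟩, (hQ v).2⟩, ?_, ?_⟩
    · rcases hQd v y hy with rfl | hlt
      · exact .inr rfl
      · refine .inl ⟨trivial, fun hyY => ?_⟩
        have h1 : d y = n := hYn hyY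
        have h2 : d v = n := hYn (hBY hvB)
        omega
    · refine Int.natCast_modEq_iff.2 (Nat.ModEq.trans ?_ hr'.symm)
      rw [← hgv]
      exact (Nat.mod_modEq _ _).symm
    · refine Int.natCast_modEq_iff.2 (Nat.ModEq.trans ?_ hs'.symm)
      rw [← hgv]
      exact (Nat.mod_modEq _ _).symm
end

section
/- Let U be an undirected graph, and for every edge e of U let (a_e, b_e, r_e, q_e) be a tuple of integers with q_e ≥ 2 and gcd(a_e,q_e) = gcd(b_e,q_e) = 1. Then there exists an integer M such that for every undirected graph G and all B₁, B₂ ⊆ E(G) with μ*(G,B₁,B₂) ≥ M, the graph G contains a subdivision of U in which for every edge e of U the corresponding branching path P_e satisfies a_e·|E(P_e)∩B₁| + b_e·|E(P_e)∩B₂| ≡ r_e (mod q_e). -/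
variable {V : Type}

/-- The number of (distinct) edges of `l` that lie in `B`. -/
noncomputable def edgeCount (l : List (Sym2 V)) (B : Set (Sym2 V)) : ℕ :=
  Nat.card {e : Sym2 V // e ∈ l ∧ e ∈ B}

/-- The induced subgraph `G[S]` contains no `(B1,B2)`-unbalanced cycle. -/
def NoUnbCycleU (G : SimpleGraph V) (B1 B2 : Set (Sym2 V)) (S : Set V) : Prop :=
  ∀ (v : V) (w : G.Walk v v), w.IsCycle → (∀ x ∈ w.support, x ∈ S) →
    edgeCount w.edges B1 = edgeCount w.edges B2

/-- `μ*(G,B1,B2)`: the least number of parts of a vertex partition of `G` each of whose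
parts induces a subgraph with no `(B1,B2)`-unbalanced cycle. -/
noncomputable def muStar (G : SimpleGraph V) (B1 B2 : Set (Sym2 V)) : ℕ :=
  sInf {k | ∃ c : V → Fin k, ∀ i : Fin k, NoUnbCycleU G B1 B2 {v | c v = i}}

/-- The edges of an (undirected) path given by its vertex list. -/
def upathEdges (vs : List V) : List (Sym2 V) :=
  (vs.zip vs.tail).map fun p => s(p.1, p.2)

/-- `vs` is a path in the graph `G` from `x` to `y`. -/
def IsUPathFromTo (G : SimpleGraph V) (vs : List V) (x y : V) : Prop :=
  vs.Nodup ∧ vs.Chain' G.Adj ∧ vs.head? = some x ∧ vs.getLast? = some y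
/-- The graph on all of `V` whose edges are the edges of `G` inside `S`. -/
def restrictTo (G : SimpleGraph V) (S : Set V) : SimpleGraph V where
  Adj u v := G.Adj u v ∧ u ∈ S ∧ v ∈ S
  symm := ⟨fun _ _ h => ⟨h.1.symm, h.2.2, h.2.1⟩⟩
  loopless := ⟨fun _ h => G.irrefl h.1⟩

/-- The sum of the weights of the edges of a walk. -/
def walkWeight {A : Type} [AddCommGroup A] {G : SimpleGraph V} (w : Sym2 V → A) {x y : V}
    (p : G.Walk x y) : A :=
  (p.edges.map w).sum

/-- There is a path from `x` to `y` in `G`, all of whose vertices lie in `S`, of weight `ρ`. -/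
def HasPath {A : Type} [AddCommGroup A] (G : SimpleGraph V) (w : Sym2 V → A) (x y : V)
    (S : Set V) (ρ : A) : Prop :=
  ∃ p : G.Walk x y, p.IsPath ∧ (∀ z ∈ p.support, z ∈ S) ∧ walkWeight w p = ρ

theorem restrictTo_le (G : SimpleGraph V) (S : Set V) : restrictTo G S ≤ G :=
  fun _ _ h => h.1

theorem restrictTo_univ (G : SimpleGraph V) : restrictTo G Set.univ = G := by
  ext; simp [restrictTo]

theorem restrictTo_restrictTo (G : SimpleGraph V) (S T : Set V) :
    restrictTo (restrictTo G S) T = restrictTo G (S ∩ T) := by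
  ext; simp only [restrictTo, Set.mem_inter_iff]; tauto

theorem support_subset_of_restrictTo {G : SimpleGraph V} {S : Set V} {x y : V}
    (p : (restrictTo G S).Walk x y) (hx : x ∈ S) : ∀ z ∈ p.support, z ∈ S := by
  induction p with
  | nil => simpa using hx
  | cons h p ih =>
    intro z hz
    rw [SimpleGraph.Walk.support_cons, List.mem_cons] at hz
    rcases hz with rfl | hz
    · exact hx
    · exact ih h.2.2 z hz

theorem mem_of_restrictTo_walk {G : SimpleGraph V} {S : Set V} {x y : V}
    (p : (restrictTo G S).Walk x y) (hxy : x ≠ y) : x ∈ S := by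
  cases p with
  | nil => exact absurd rfl hxy
  | cons h p => exact h.2.1

theorem colorable_union {G : SimpleGraph V} {A B : Set V} {m k : ℕ}
    (hA : (restrictTo G A).Colorable m) (hB : (restrictTo G B).Colorable k) :
    (restrictTo G (A ∪ B)).Colorable (m + k) := by
  classical
  obtain ⟨f⟩ := hA
  obtain ⟨g⟩ := hB
  have C : (restrictTo G (A ∪ B)).Coloring (Fin m ⊕ Fin k) :=
    SimpleGraph.Coloring.mk (fun v => if v ∈ A then Sum.inl (f v) else Sum.inr (g v)) (by
      intro u v ⟨h, hu, hv⟩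
      by_cases h1 : u ∈ A <;> by_cases h2 : v ∈ A <;> simp only [h1, h2, if_true, if_false, ne_eq,
        reduceCtorEq, not_false_eq_true, Sum.inl.injEq, Sum.inr.injEq]
      · exact f.valid ⟨h, h1, h2⟩
      · exact g.valid ⟨h, hu.resolve_left h1, hv.resolve_left h2⟩)
  simpa using C.colorable

theorem colorable_singleton (G : SimpleGraph V) (v : V) :
    (restrictTo G {v}).Colorable 1 := by
  rw [SimpleGraph.colorable_one_iff]
  ext x y
  simp only [restrictTo, Set.mem_singleton_iff, SimpleGraph.bot_adj, iff_false]
  rintro ⟨h, rfl, rfl⟩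
  exact G.irrefl h

theorem colorable_restrictTo_empty (G : SimpleGraph V) : (restrictTo G ∅).Colorable 1 := by
  rw [SimpleGraph.colorable_one_iff]
  ext x y
  simp [restrictTo]

theorem exists_subset_not_colorable [Finite V] {G : SimpleGraph V} {S : Set V} {m k : ℕ}
    (hm : 1 ≤ m) (h : ¬ (restrictTo G S).Colorable (m + 1 + k)) :
    ∃ X ⊆ S, ¬ (restrictTo G X).Colorable m ∧ ¬ (restrictTo G (S \ X)).Colorable k := by
  obtain ⟨Y, hY⟩ := Set.Finite.exists_maximal
    (s := {Y : Set V | Y ⊆ S ∧ (restrictTo G Y).Colorable m}) (Set.toFinite _)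
    ⟨∅, Set.empty_subset _, (colorable_restrictTo_empty G).mono hm⟩
  obtain ⟨v, hvS, hvY⟩ : ∃ v ∈ S, v ∉ Y := by
    by_contra! hc
    rw [hY.prop.1.antisymm hc] at hY
    exact h (hY.prop.2.mono (by omega))
  have hsub : Y ∪ {v} ⊆ S := Set.union_subset hY.prop.1 (by simpa using hvS)
  refine ⟨Y ∪ {v}, hsub, fun hc => ?_, fun hc => h ?_⟩
  · exact hvY (hY.le_of_ge ⟨hsub, hc⟩ Set.subset_union_left (by simp))
  · have := colorable_union (colorable_union hY.prop.2 (colorable_singleton G v)) hc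
    rwa [Set.union_sdiff_cancel hsub] at this

theorem SimpleGraph.Walk.IsPath.append_of_inter {G : SimpleGraph V} {x y z : V} {p : G.Walk x y}
    {q : G.Walk y z} (hp : p.IsPath) (hq : q.IsPath)
    (h : ∀ v ∈ p.support, v ∈ q.support → v = y) : (p.append q).IsPath := by
  rw [SimpleGraph.Walk.isPath_def, SimpleGraph.Walk.support_append, List.nodup_append']
  have hq' := hq.support_nodup
  rw [← SimpleGraph.Walk.cons_tail_support, List.nodup_cons] at hq'
  refine ⟨hp.support_nodup, hq'.2, fun v hv hv' => ?_⟩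
  exact hq'.1 (h v hv (List.mem_of_mem_tail hv') ▸ hv')

section Weights

variable {A : Type} [AddCommGroup A] {G : SimpleGraph V} {w : Sym2 V → A}

theorem walkWeight_append {x y z : V} (p : G.Walk x y) (q : G.Walk y z) :
    walkWeight w (p.append q) = walkWeight w p + walkWeight w q := by
  simp [walkWeight]

theorem HasPath.mono {x y : V} {S T : Set V} {ρ : A} (h : HasPath G w x y S ρ) (hST : S ⊆ T) :
    HasPath G w x y T ρ := by
  obtain ⟨p, hp, hS, hw⟩ := h
  exact ⟨p, hp, fun z hz => hST (hS z hz), hw⟩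

theorem HasPath.trans {x y z : V} {S T : Set V} {ρ σ : A} (h₁ : HasPath G w x y S ρ)
    (h₂ : HasPath G w y z T σ) (hST : ∀ v ∈ S, v ∈ T → v = y) :
    HasPath G w x z (S ∪ T) (ρ + σ) := by
  obtain ⟨p, hp, hpS, rfl⟩ := h₁
  obtain ⟨q, hq, hqT, rfl⟩ := h₂
  refine ⟨p.append q, hp.append_of_inter hq fun v hv hv' => hST v (hpS v hv) (hqT v hv'), ?_,
    walkWeight_append p q⟩
  intro v hv
  rw [SimpleGraph.Walk.mem_support_append_iff] at hv
  exact hv.imp (hpS v) (hqT v)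

/-- A geodesic from a root meets the distance class of its end only in that end. -/
theorem exists_walk_dist_lt {r x : V} (h : G.Reachable r x) :
    ∃ p : G.Walk r x, ∀ z ∈ p.support, z = x ∨ G.dist r z < G.dist r x := by
  classical
  obtain ⟨p, hp⟩ := h.exists_walk_length_eq_dist
  refine ⟨p, fun z hz => or_iff_not_imp_left.mpr fun hzx => ?_⟩
  rw [← hp]
  exact (SimpleGraph.dist_le _).trans_lt (p.length_takeUntil_lt_length hz hzx)

theorem exists_level_not_colorable {k : ℕ} (h : ¬ G.Colorable (2 * k)) :
    ∃ T : Set V, ¬ (restrictTo G T).Colorable k ∧ ∀ x ∈ T, ∀ y ∈ T, x ≠ y →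
      ∃ p : G.Walk x y, p.IsPath ∧ ∀ z ∈ p.support, z = x ∨ z = y ∨ z ∉ T := by
  classical
  obtain ⟨root, hroot⟩ : ∃ root : G.ConnectedComponent → V,
      ∀ c, G.connectedComponentMk (root c) = c :=
    (Quot.mk_surjective (r := G.Reachable)).hasRightInverse
  let L (c : G.ConnectedComponent) (n : ℕ) : Set V :=
    {v | G.connectedComponentMk v = c ∧ G.dist (root c) v = n}
  have hreach : ∀ c n, ∀ v ∈ L c n, G.Reachable (root c) v := by
    intro c n v hv
    rw [← SimpleGraph.ConnectedComponent.eq, hv.1, hroot]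
  by_contra! hc
  have hcol : ∀ c n, (restrictTo G (L c n)).Colorable k := by
    intro c n
    by_contra hcol
    obtain ⟨x, hx, y, hy, hxy, hp⟩ := hc (L c n) hcol
    obtain ⟨p, hp'⟩ := exists_walk_dist_lt (hreach c n x hx)
    obtain ⟨q, hq'⟩ := exists_walk_dist_lt (hreach c n y hy)
    obtain ⟨z, hz, hzx, hzy, hzT⟩ :=
      hp (p.reverse.append q).bypass (SimpleGraph.Walk.bypass_isPath _)
    have hz' := SimpleGraph.Walk.support_bypass_subset_support _ hz
    rw [SimpleGraph.Walk.mem_support_append_iff, SimpleGraph.Walk.support_reverse,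
      List.mem_reverse] at hz'
    have h1 := hx.2
    have h2 := hy.2
    have h3 := hzT.2
    rcases hz' with hz' | hz'
    · exact absurd ((hp' z hz').resolve_left hzx) (by omega)
    · exact absurd ((hq' z hz').resolve_left hzy) (by omega)
  let comp (v : V) := G.connectedComponentMk v
  let d (v : V) := G.dist (root (comp v)) v
  apply h
  have D : G.Coloring (Fin 2 × Fin k) :=
    SimpleGraph.Coloring.mk (fun v => (⟨d v % 2, by omega⟩, (hcol (comp v) (d v)).some v)) (by
      intro u v huv heq
      have hcomp : comp u = comp v := SimpleGraph.ConnectedComponent.eq.mpr huv.reachable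
      simp only [Prod.mk.injEq, Fin.mk.injEq] at heq
      have hdiff := huv.diff_dist_adj (u := (root (comp u)))
      have hd : d u = d v := by
        have h1 : d u = G.dist (root (comp u)) u := rfl
        have h2 : d v = G.dist (root (comp u)) v := by rw [hcomp]
        omega
      have h2 := heq.2
      rw [hcomp, hd] at h2
      exact (hcol (comp v) (d v)).some.valid
        (show (restrictTo G _).Adj u v from ⟨huv, ⟨hcomp, hcomp ▸ hd⟩, ⟨rfl, rfl⟩⟩) h2)
  simpa using D.colorable

theorem exists_joined_subset {S : Set V} {k : ℕ} (w : Sym2 V → A)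
    (h : ¬ (restrictTo G S).Colorable (2 * k)) :
    ∃ T ⊆ S, ¬ (restrictTo G T).Colorable k ∧ ∀ x ∈ T, ∀ y ∈ T, x ≠ y →
      ∃ σ, HasPath G w x y ({x, y} ∪ S \ T) σ := by
  obtain ⟨T, hT, hp⟩ := exists_level_not_colorable h
  rw [restrictTo_restrictTo] at hT
  refine ⟨S ∩ T, Set.inter_subset_left, hT, fun x hx y hy hxy => ?_⟩
  obtain ⟨p, hp, hz⟩ := hp x hx.2 y hy.2 hxy
  refine ⟨_, p.mapLe (restrictTo_le G S), hp.mapLe _, fun z hzp => ?_, rfl⟩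
  rw [SimpleGraph.Walk.support_mapLe_eq_support] at hzp
  have h1 := support_subset_of_restrictTo p hx.1 z hzp
  have h2 := hz z hzp
  simp only [Set.mem_union, Set.mem_insert_iff, Set.mem_singleton_iff, Set.mem_sdiff,
    Set.mem_inter_iff]
  tauto

theorem exists_paths_weight_sub_notMem [Finite A] (K : AddSubgroup A)
    (hw : ∀ e ∈ G.edgeSet, w e ∉ K) (h : ¬ G.Colorable (Nat.card A)) :
    ∃ (s t : V) (p p' : G.Walk s t), p.IsPath ∧ p'.IsPath ∧
      walkWeight w p - walkWeight w p' ∉ K := by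
  classical
  by_contra! hc
  have key : ∀ (r r' x y : V) (p : G.Walk r x) (p' : G.Walk r' y), p.IsPath → p'.IsPath →
      r = r' → G.Adj x y → walkWeight w p - walkWeight w p' ∉ K := by
    rintro r _ x y p p' hp hp' rfl hxy hK
    apply hw s(x, y) hxy
    by_cases hy : y ∈ p.support
    · have h1 := hc r y (p.takeUntil y hy) p' (hp.takeUntil hy) hp'
      have h2 := hc y x (p.dropUntil y hy) (hxy.symm.toWalk) (hp.dropUntil hy)
        (SimpleGraph.Walk.IsPath.of_adj hxy.symm)
      have h3 : walkWeight w hxy.symm.toWalk = w s(x, y) := by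
        simp [walkWeight, Sym2.eq_swap]
      have h4 : walkWeight w p = walkWeight w (p.takeUntil y hy) +
          walkWeight w (p.dropUntil y hy) := by
        rw [← walkWeight_append, SimpleGraph.Walk.take_spec]
      rw [h3] at h2
      rw [h4] at hK
      have := K.sub_mem hK (K.add_mem h1 h2)
      convert this using 1
      abel
    · have h1 := hc r y (p.concat hxy) p' (hp.concat hy hxy) hp'
      have h2 : walkWeight w (p.concat hxy) = walkWeight w p + w s(x, y) := by
        simp [walkWeight]
      rw [h2] at h1
      have := K.sub_mem h1 hK
      convert this using 1
      abel
  obtain ⟨root, hroot⟩ : ∃ root : G.ConnectedComponent → V,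
      ∀ c, G.connectedComponentMk (root c) = c :=
    (Quot.mk_surjective (r := G.Reachable)).hasRightInverse
  have hpath (v : V) : ∃ p : G.Walk (root (G.connectedComponentMk v)) v, p.IsPath :=
    (SimpleGraph.ConnectedComponent.eq.mp (hroot _)).exists_isPath
  choose P hP using hpath
  let C : G.Coloring (A ⧸ K) := SimpleGraph.Coloring.mk (fun v => ((walkWeight w (P v) : A) : A ⧸ K)) (by
    intro x y hxy heq
    rw [eq_comm, QuotientAddGroup.eq, neg_add_eq_sub] at heq
    have hcomp : G.connectedComponentMk x = G.connectedComponentMk y :=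
      SimpleGraph.ConnectedComponent.eq.mpr hxy.reachable
    exact key _ _ x y (P x) (P y) (hP x) (hP y) (congrArg root hcomp) hxy heq)
  have : Fintype (A ⧸ K) := Fintype.ofFinite _
  refine h (C.colorable.mono ?_)
  rw [← Nat.card_eq_fintype_card]
  exact Nat.card_le_card_of_surjective _ (QuotientAddGroup.mk_surjective (s := K))

theorem exists_hasPath_weight_sub_notMem [Finite A] {X : Set V} (K : AddSubgroup A)
    (hw : ∀ e ∈ G.edgeSet, w e ∉ K) (h : ¬ (restrictTo G X).Colorable (Nat.card A)) :
    ∃ s ∈ X, ∃ t ∈ X, ∃ α β, HasPath G w s t X α ∧ HasPath G w s t X β ∧ α - β ∉ K := by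
  obtain ⟨s, t, p, p', hp, hp', hK⟩ := exists_paths_weight_sub_notMem K
    (fun e he => hw e (SimpleGraph.edgeSet_mono (restrictTo_le G X) he)) h
  have hst : s ≠ t := by
    rintro rfl
    rw [SimpleGraph.Walk.isPath_iff_nil] at hp hp'
    rw [SimpleGraph.Walk.eq_nil_iff_nil.mpr hp, SimpleGraph.Walk.eq_nil_iff_nil.mpr hp',
      sub_self] at hK
    exact hK K.zero_mem
  have hs := mem_of_restrictTo_walk p hst
  have hpath (q : (restrictTo G X).Walk s t) (hq : q.IsPath) :
      HasPath G w s t X (walkWeight w q) := by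
    refine ⟨q.mapLe (restrictTo_le G X), hq.mapLe _, fun z hz => ?_, ?_⟩
    · rw [SimpleGraph.Walk.support_mapLe_eq_support] at hz
      exact support_subset_of_restrictTo q hs z hz
    · simp [walkWeight]
  exact ⟨s, hs, t, mem_of_restrictTo_walk p.reverse hst.symm, _, _, hpath p hp, hpath p' hp', hK⟩

end Weights

section Residues

variable {n : ℕ} [NeZero n] {G : SimpleGraph V} {w : Sym2 V → ZMod n}

open scoped Pointwise in
/-- A nonempty proper subset of the residues grows when two of its translates are joined,
provided that the difference of the translations is not one of its periods; units never are
periods. -/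
theorem exists_addSubgroup_card_lt {R : Finset (ZMod n)} (hR : R.Nonempty)
    (hR' : R ≠ Finset.univ) :
    ∃ K : AddSubgroup (ZMod n), (∀ u : ZMod n, IsUnit u → u ∉ K) ∧
      ∀ α β : ZMod n, α - β ∉ K → R.card < ((α +ᵥ R) ∪ (β +ᵥ R)).card := by
  refine ⟨AddAction.stabilizer (ZMod n) R, fun u hu hK => hR' ?_, fun α β hK => ?_⟩
  · obtain ⟨r, hr⟩ := hR
    refine Finset.eq_univ_iff_forall.mpr fun x => ?_
    obtain ⟨v, hv⟩ := hu.exists_left_inv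
    have hx : ((x - r) * v).val • u ∈ AddAction.stabilizer (ZMod n) R :=
      AddSubgroup.nsmul_mem _ hK _
    rw [nsmul_eq_mul, ZMod.natCast_zmod_val, mul_assoc, hv, mul_one,
      AddAction.mem_stabilizer_iff] at hx
    rw [← hx]
    simpa using Finset.vadd_mem_vadd_finset (a := x - r) hr
  · by_contra! hle
    apply hK
    have hα : α +ᵥ R = (α +ᵥ R) ∪ (β +ᵥ R) :=
      Finset.eq_of_subset_of_card_le Finset.subset_union_left (by simpa using hle)
    have hβ : β +ᵥ R = (α +ᵥ R) ∪ (β +ᵥ R) :=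
      Finset.eq_of_subset_of_card_le Finset.subset_union_right (by simpa using hle)
    rw [AddAction.mem_stabilizer_iff, sub_eq_neg_add, add_vadd, hα, ← hβ, neg_vadd_vadd]

/-- A bound on the number of colors that forces a pair of vertices joined by paths of at least
`j + 1` residues, away from a set that needs more than `k` colors. -/
def chainBound (n : ℕ) : ℕ → ℕ → ℕ
  | 0, k => 1 + k
  | j + 1, k => 2 * chainBound n j (n + 1 + k)

open scoped Pointwise in
theorem exists_chain [Finite V] (hw : ∀ e ∈ G.edgeSet, IsUnit (w e)) (j : ℕ) :
    ∀ (k : ℕ) (S : Set V), ¬ (restrictTo G S).Colorable (chainBound n j k) →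
      ∃ T ⊆ S, ¬ (restrictTo G T).Colorable k ∧ ∃ s ∈ S \ T, ∃ t ∈ S \ T,
        ∃ R : Finset (ZMod n), R.Nonempty ∧ (R = Finset.univ ∨ j < R.card) ∧
          ∀ ρ ∈ R, HasPath G w s t (S \ T) ρ := by
  induction j with
  | zero =>
    intro k S h
    have hne : S.Nonempty := by
      by_contra hS
      rw [Set.not_nonempty_iff_eq_empty] at hS
      subst hS
      exact h ((colorable_restrictTo_empty G).mono (by simp [chainBound]))
    obtain ⟨v, hv⟩ := hne
    refine ⟨S \ {v}, Set.sdiff_subset, fun hc => h ?_, v, by simpa using hv, v, by simpa using hv,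
      {0}, by simp, by simp, fun ρ hρ => ?_⟩
    · have := colorable_union (colorable_singleton G v) hc
      rwa [Set.union_sdiff_cancel (by simpa using hv)] at this
    · rw [Finset.mem_singleton.mp hρ]
      exact ⟨.nil, .nil, by simpa using hv, by simp [walkWeight]⟩
  | succ j ih =>
    intro k S h
    obtain ⟨T₁, hT₁, hcol₁, hjoin⟩ := exists_joined_subset w h
    obtain ⟨T₂, hT₂, hcol₂, s, hs, t, ht, R, hne, hR, hpath⟩ := ih _ T₁ hcol₁
    obtain ⟨X, hX, hcolX, hcol⟩ := exists_subset_not_colorable (NeZero.one_le) hcol₂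
    by_cases hRu : R = Finset.univ
    · refine ⟨T₂ \ X, fun z hz => hT₁ (hT₂ hz.1), hcol, s, ⟨hT₁ hs.1, fun hz => hs.2 hz.1⟩, t,
        ⟨hT₁ ht.1, fun hz => ht.2 hz.1⟩, R, hne, Or.inl hRu, fun ρ hρ => (hpath ρ hρ).mono ?_⟩
      exact fun z hz => ⟨hT₁ hz.1, fun hz' => hz.2 hz'.1⟩
    obtain ⟨K, hunit, hcard⟩ := exists_addSubgroup_card_lt hne hRu
    obtain ⟨s', hs', t', ht', α, β, hα, hβ, hK⟩ := exists_hasPath_weight_sub_notMem (X := X) K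
      (fun e he => hunit _ (hw e he)) (by simpa using hcolX)
    obtain ⟨σ, hσ⟩ := hjoin t ht.1 s' (hT₂ (hX hs')) (by rintro rfl; exact ht.2 (hX hs'))
    have hcat : ∀ ρ ∈ R, ∀ γ, HasPath G w s' t' X γ →
        HasPath G w s t' (S \ (T₂ \ X)) (ρ + σ + γ) := by
      intro ρ hρ γ hγ
      refine (((hpath ρ hρ).trans hσ ?_).trans hγ ?_).mono ?_
      · rintro v hv ((rfl | rfl) | hv')
        · rfl
        · exact absurd (hX hs') hv.2
        · exact absurd hv.1 hv'.2
      · rintro v (hv | (rfl | rfl) | hv') hvX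
        · exact absurd (hX hvX) hv.2
        · exact absurd (hX hvX) ht.2
        · rfl
        · exact absurd (hT₂ (hX hvX)) hv'.2
      · rintro v ((hv | (rfl | rfl) | hv) | hv)
        · exact ⟨hT₁ hv.1, fun h => hv.2 h.1⟩
        · exact ⟨hT₁ ht.1, fun h => ht.2 h.1⟩
        · exact ⟨hT₁ (hT₂ (hX hs')), fun h => h.2 hs'⟩
        · exact ⟨hv.1, fun h => hv.2 (hT₂ h.1)⟩
        · exact ⟨hT₁ (hT₂ (hX hv)), fun h => h.2 hv⟩
    have hlt := hcard (σ + α) (σ + β) (by simpa using hK)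
    refine ⟨T₂ \ X, fun z hz => hT₁ (hT₂ hz.1), hcol, s, ⟨hT₁ hs.1, fun hz => hs.2 hz.1⟩, t',
      ⟨hT₁ (hT₂ (hX ht')), fun hz => hz.2 ht'⟩, ((σ + α) +ᵥ R) ∪ ((σ + β) +ᵥ R), ?_,
      Or.inr ((Nat.succ_le_of_lt (hR.resolve_left hRu)).trans_lt hlt), ?_⟩
    · exact hne.vadd_finset.mono Finset.subset_union_left
    · intro ρ hρ
      rw [Finset.mem_union, Finset.mem_vadd_finset, Finset.mem_vadd_finset] at hρ
      rcases hρ with ⟨ρ', hρ', rfl⟩ | ⟨ρ', hρ', rfl⟩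
      · convert hcat ρ' hρ' α hα using 1
        rw [vadd_eq_add]; ring
      · convert hcat ρ' hρ' β hβ using 1
        rw [vadd_eq_add]; ring

theorem exists_all_residues [Finite V] (hw : ∀ e ∈ G.edgeSet, IsUnit (w e)) {k : ℕ} {S : Set V}
    (h : ¬ (restrictTo G S).Colorable (2 * (2 * chainBound n n k))) :
    ∃ T ⊆ S, ¬ (restrictTo G T).Colorable k ∧ ∀ x ∈ T, ∀ y ∈ T, x ≠ y →
      ∀ ρ, HasPath G w x y ({x, y} ∪ S \ T) ρ := by
  obtain ⟨T₁, hT₁, hcol₁, hjoin₁⟩ := exists_joined_subset w h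
  obtain ⟨T₂, hT₂, hcol₂, hjoin₂⟩ := exists_joined_subset w hcol₁
  obtain ⟨T, hT, hcol, s, hs, t, ht, R, -, hR, hpath⟩ := exists_chain hw n k T₂ hcol₂
  have hRu : R = Finset.univ := hR.resolve_right fun hlt => by
    have := R.card_le_univ
    rw [ZMod.card] at this
    omega
  subst hRu
  refine ⟨T, fun z hz => hT₁ (hT₂ (hT hz)), hcol, fun x hx y hy hxy ρ => ?_⟩
  obtain ⟨σ₁, h₁⟩ := hjoin₁ x (hT₂ (hT hx)) s (hT₂ hs.1) (by rintro rfl; exact hs.2 hx)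
  obtain ⟨σ₂, h₂⟩ := hjoin₂ t ht.1 y (hT hy) (by rintro rfl; exact ht.2 hy)
  have h₃ := hpath (ρ - σ₁ - σ₂) (Finset.mem_univ _)
  have h₄ := ((h₁.trans h₃ ?_).trans h₂ ?_).mono (T := {x, y} ∪ S \ T) ?_
  · convert h₄ using 1
    ring
  · rintro v ((rfl | rfl) | hv) hv'
    · exact absurd hx hv'.2
    · rfl
    · exact absurd (hT₂ hv'.1) hv.2
  · rintro v (((rfl | rfl) | hv) | hv) ((rfl | rfl) | hv')
    any_goals rfl
    · exact absurd rfl hxy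
    · exact absurd (hT hx) hv'.2
    · exact absurd hy hs.2
    · exact absurd hs.1 hv'.2
    · exact absurd (hT₂ (hT hy)) hv.2
    · exact absurd hv'.1 hv.2
    · exact absurd hy hv.2
    · exact absurd hv.1 hv'.2
  · rintro v ((((rfl | rfl) | hv) | hv) | (rfl | rfl) | hv)
    · simp
    · exact Or.inr ⟨hT₁ (hT₂ hs.1), hs.2⟩
    · exact Or.inr ⟨hv.1, fun h => hv.2 (hT₂ (hT h))⟩
    · exact Or.inr ⟨hT₁ (hT₂ hv.1), hv.2⟩
    · exact Or.inr ⟨hT₁ (hT₂ ht.1), ht.2⟩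
    · simp
    · exact Or.inr ⟨hT₁ hv.1, fun h => hv.2 (hT h)⟩

end Residues

theorem exists_disjoint_routes {ι : Type} (n : ι → ℕ) (E : Finset ι) (hn : ∀ i ∈ E, n i ≠ 0)
    (k : ℕ) : ∃ N : ℕ, ∀ (V : Type) [Finite V] (G : SimpleGraph V)
      (w : ∀ i, Sym2 V → ZMod (n i)), (∀ i ∈ E, ∀ e ∈ G.edgeSet, IsUnit (w i e)) →
      ∀ S : Set V, ¬ (restrictTo G S).Colorable N →
      ∃ T ⊆ S, ¬ (restrictTo G T).Colorable k ∧ ∃ A : ι → Set V, (∀ i ∈ E, A i ⊆ S \ T) ∧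
        (∀ i ∈ E, ∀ j ∈ E, i ≠ j → Disjoint (A i) (A j)) ∧
        ∀ i ∈ E, ∀ x ∈ T, ∀ y ∈ T, x ≠ y → ∀ ρ, HasPath G (w i) x y ({x, y} ∪ A i) ρ := by
  classical
  induction E using Finset.induction_on with
  | empty => exact ⟨k, fun V _ G w _ S h => ⟨S, subset_rfl, h, fun _ => ∅, by simp⟩⟩
  | insert i E hi ih =>
    obtain ⟨N, hN⟩ := ih fun j hj => hn j (Finset.mem_insert_of_mem hj)
    have : NeZero (n i) := ⟨hn i (Finset.mem_insert_self i E)⟩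
    refine ⟨2 * (2 * chainBound (n i) (n i) N), fun V _ G w hw S h => ?_⟩
    obtain ⟨T₁, hT₁, hcol₁, hpath₁⟩ :=
      exists_all_residues (hw i (Finset.mem_insert_self i E)) h
    obtain ⟨T, hT, hcol, A, hA, hdisj, hpath⟩ :=
      hN V G w (fun j hj => hw j (Finset.mem_insert_of_mem hj)) T₁ hcol₁
    have hne : ∀ j ∈ E, j ≠ i := fun j hj h => hi (h ▸ hj)
    have hi_disj : ∀ j ∈ E, Disjoint (S \ T₁) (A j) := fun j hj =>
      Set.disjoint_left.mpr fun z hz hz' => hz.2 (hA j hj hz').1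
    refine ⟨T, hT.trans hT₁, hcol, Function.update A i (S \ T₁), fun j hj => ?_,
      fun j hj l hl hjl => ?_, fun j hj x hx y hy hxy ρ => ?_⟩
    · rcases Finset.mem_insert.mp hj with rfl | hj
      · rw [Function.update_self]
        exact Set.sdiff_subset_sdiff_right hT
      · rw [Function.update_of_ne (hne j hj)]
        exact (hA j hj).trans (Set.sdiff_subset_sdiff_left hT₁)
    · rcases Finset.mem_insert.mp hj with rfl | hj' <;>
        rcases Finset.mem_insert.mp hl with rfl | hl'
      · exact absurd rfl hjl
      · rw [Function.update_self, Function.update_of_ne (hne l hl')]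
        exact hi_disj l hl'
      · rw [Function.update_self, Function.update_of_ne (hne j hj')]
        exact (hi_disj j hj').symm
      · rw [Function.update_of_ne (hne j hj'), Function.update_of_ne (hne l hl')]
        exact hdisj j hj' l hl' hjl
    · rcases Finset.mem_insert.mp hj with rfl | hj
      · rw [Function.update_self]
        exact hpath₁ x (hT hx) y (hT hy) hxy ρ
      · rw [Function.update_of_ne (hne j hj)]
        exact hpath j hj x hx y hy hxy ρ

theorem exists_injective_of_not_colorable {W : Type} [Fintype W] [Finite V] {G : SimpleGraph V}
    {T : Set V} (h : ¬ (restrictTo G T).Colorable (Fintype.card W + 1)) :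
    ∃ φ : W → V, Function.Injective φ ∧ ∀ u, φ u ∈ T := by
  classical
  have := Fintype.ofFinite V
  suffices hcard : Fintype.card W ≤ Fintype.card T by
    obtain ⟨f⟩ := Function.Embedding.nonempty_of_card_le hcard
    exact ⟨fun u => f u, Subtype.val_injective.comp f.injective, fun u => (f u).2⟩
  by_contra! hlt
  obtain ⟨f⟩ := Function.Embedding.nonempty_of_card_le hlt.le
  have C : (restrictTo G T).Coloring (Option W) :=
    SimpleGraph.Coloring.mk (fun v => if hv : v ∈ T then some (f ⟨v, hv⟩) else none) (by
      rintro u v ⟨huv, hu, hv⟩ heq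
      simp only [hu, hv, dite_true, Option.some.injEq, EmbeddingLike.apply_eq_iff_eq,
        Subtype.mk.injEq] at heq
      exact huv.ne heq)
  simpa using h (by simpa using C.colorable)

/-- The subgraph of the edges of `G` that lie in exactly one of `B1` and `B2`. -/
def symmDiffGraph (G : SimpleGraph V) (B1 B2 : Set (Sym2 V)) : SimpleGraph V where
  Adj u v := G.Adj u v ∧ ¬ (s(u, v) ∈ B1 ↔ s(u, v) ∈ B2)
  symm := ⟨fun u v h => ⟨h.1.symm, by rw [Sym2.eq_swap]; exact h.2⟩⟩
  loopless := ⟨fun _ h => G.irrefl h.1⟩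

theorem muStar_le_of_colorable {G : SimpleGraph V} {B1 B2 : Set (Sym2 V)} {k : ℕ}
    (h : (symmDiffGraph G B1 B2).Colorable k) : muStar G B1 B2 ≤ k := by
  obtain ⟨c⟩ := h
  refine Nat.sInf_le ⟨c, fun i v p _ hp => ?_⟩
  refine Nat.card_congr (Equiv.subtypeEquivRight fun e => and_congr_right fun he => ?_)
  induction e using Sym2.ind with
  | _ x y =>
    by_contra hB
    refine c.valid (v := x) (w := y) ⟨p.adj_of_mem_edges he, hB⟩ ?_
    rw [hp x (p.fst_mem_support_of_mem_edges he), hp y (p.snd_mem_support_of_mem_edges he)]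

theorem upathEdges_support {G : SimpleGraph V} {x y : V} (p : G.Walk x y) :
    upathEdges p.support = p.edges := by
  rw [SimpleGraph.Walk.edges_eq_zipWith_support, upathEdges, List.zip, List.map_zipWith]

open Classical in
theorem sum_map_edges {n : ℕ} (a b : ℤ) (B1 B2 : Set (Sym2 V)) {l : List (Sym2 V)}
    (hl : l.Nodup) :
    (l.map fun e => (a : ZMod n) * (if e ∈ B1 then 1 else 0) + b * (if e ∈ B2 then 1 else 0)).sum =
      ((a * edgeCount l B1 + b * edgeCount l B2 : ℤ) : ZMod n) := by
  have hcount (B : Set (Sym2 V)) : edgeCount l B = (l.toFinset.filter (· ∈ B)).card :=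
    Nat.subtype_card _ (by simp)
  rw [← List.sum_toFinset _ hl, Finset.sum_add_distrib, ← Finset.mul_sum, ← Finset.mul_sum,
    Finset.sum_boole, Finset.sum_boole, hcount, hcount]
  push_cast
  rfl

theorem mem_support_of_mem_internalVerts {G : SimpleGraph V} {x y : V} {p : G.Walk x y}
    (hp : p.IsPath) {z : V} (hz : z ∈ internalVerts p.support) :
    z ∈ p.support ∧ z ≠ x ∧ z ≠ y := by
  have hz' := List.mem_of_mem_dropLast hz
  have h1 := hp.support_nodup
  refine ⟨List.mem_of_mem_tail hz', ?_, ?_⟩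
  · rintro rfl
    rw [← SimpleGraph.Walk.cons_tail_support, List.nodup_cons] at h1
    exact h1.1 hz'
  · rintro rfl
    have hne : p.support.tail ≠ [] := List.ne_nil_of_mem hz'
    have h2 := h1.tail
    rw [← List.dropLast_append_getLast hne, List.nodup_append'] at h2
    refine h2.2.2 hz ?_
    rw [List.getLast_tail, SimpleGraph.Walk.getLast_support]
    exact List.mem_singleton_self _

theorem isUnit_intCast_zmod {n : ℕ} {a m : ℤ} (hm : (n : ℤ) = m) (h : Int.gcd a m = 1) :
    IsUnit (a : ZMod n) := by
  rw [ZMod.coe_int_isUnit_iff_isCoprime, hm, isCoprime_comm]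
  exact Int.isCoprime_iff_gcd_eq_one.mpr h

/-- (Corollary 4.5 of the paper, the undirected analogue.) -/
theorem stmt18 {W : Type} [Fintype W] (U : SimpleGraph W)
    (a b r q : Sym2 W → ℤ)
    (hq : ∀ e ∈ U.edgeSet, 2 ≤ q e)
    (hgcd : ∀ e ∈ U.edgeSet, Int.gcd (a e) (q e) = 1 ∧ Int.gcd (b e) (q e) = 1) :
    ∃ M : ℕ, ∀ (V : Type) [Fintype V] (G : SimpleGraph V) (B1 B2 : Set (Sym2 V)),
      M ≤ muStar G B1 B2 →
      ∃ (φ : W → V) (P : Sym2 W → List V),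
        Function.Injective φ ∧
        -- each edge e = uv of U is replaced by a path of length ≥ 1 from φ u to φ v
        (∀ e ∈ U.edgeSet, ∃ u v : W, e = s(u, v) ∧
          IsUPathFromTo G (P e) (φ u) (φ v) ∧ 2 ≤ (P e).length) ∧
        -- internal vertices avoid the branch vertices
        (∀ e ∈ U.edgeSet, ∀ w ∈ internalVerts (P e), w ∉ Set.range φ) ∧
        -- the branching paths are pairwise internally vertex-disjoint
        (∀ e ∈ U.edgeSet, ∀ f ∈ U.edgeSet, e ≠ f →
          ∀ w ∈ internalVerts (P e), w ∉ internalVerts (P f)) ∧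
        -- the congruence constraints
        (∀ e ∈ U.edgeSet,
          a e * (edgeCount (upathEdges (P e)) B1 : ℤ) +
            b e * (edgeCount (upathEdges (P e)) B2 : ℤ) ≡ r e [ZMOD q e]) := by
  classical
  let E := (Set.toFinite U.edgeSet).toFinset
  have hE : ∀ e, e ∈ E ↔ e ∈ U.edgeSet := fun e => Set.Finite.mem_toFinset _
  let n (e : Sym2 W) : ℕ := (q e).toNat
  have hn : ∀ e ∈ U.edgeSet, (n e : ℤ) = q e := fun e he =>
    Int.toNat_of_nonneg (by linarith [hq e he])
  obtain ⟨N, hN⟩ := exists_disjoint_routes n E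
    (fun e he => by have := hn e ((hE e).mp he); have := hq e ((hE e).mp he); omega)
    (Fintype.card W + 1)
  refine ⟨N + 1, fun V _ G B1 B2 hM => ?_⟩
  let w (e : Sym2 W) (d : Sym2 V) : ZMod (n e) :=
    (a e : ZMod (n e)) * (if d ∈ B1 then 1 else 0) + b e * (if d ∈ B2 then 1 else 0)
  have hw : ∀ e ∈ E, ∀ d ∈ (symmDiffGraph G B1 B2).edgeSet, IsUnit (w e d) := by
    intro e he d hd
    have he := (hE e).mp he
    have ha := isUnit_intCast_zmod (hn e he) (hgcd e he).1
    have hb := isUnit_intCast_zmod (hn e he) (hgcd e he).2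
    induction d using Sym2.ind with
    | _ x y =>
      have hxy : ¬ (s(x, y) ∈ B1 ↔ s(x, y) ∈ B2) := hd.2
      by_cases h1 : s(x, y) ∈ B1 <;> by_cases h2 : s(x, y) ∈ B2 <;> simp_all [w]
  obtain ⟨T, -, hcol, A, hA, hdisj, hpath⟩ := hN V (symmDiffGraph G B1 B2) w hw Set.univ
    (fun hc => by
      rw [restrictTo_univ] at hc
      have := muStar_le_of_colorable hc
      omega)
  obtain ⟨φ, hφ, hφT⟩ := exists_injective_of_not_colorable hcol
  have hroute : ∀ e, ∃ l : List V, e ∈ U.edgeSet →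
      (∃ u v : W, e = s(u, v) ∧ IsUPathFromTo G l (φ u) (φ v) ∧ 2 ≤ l.length) ∧
      (∀ z ∈ internalVerts l, z ∈ A e) ∧
      a e * (edgeCount (upathEdges l) B1 : ℤ) + b e * (edgeCount (upathEdges l) B2 : ℤ) ≡
        r e [ZMOD q e] := by
    intro e
    by_cases he : e ∈ U.edgeSet
    swap
    · exact ⟨[], fun h => absurd h he⟩
    induction e using Sym2.ind with
    | _ u v =>
      have huv : φ u ≠ φ v := hφ.ne (SimpleGraph.Adj.ne he)
      obtain ⟨p, hp, hpA, hpw⟩ :=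
        hpath s(u, v) ((hE _).mpr he) (φ u) (hφT u) (φ v) (hφT v) huv (r s(u, v))
      refine ⟨p.support, fun _ => ⟨⟨u, v, rfl, ⟨hp.support_nodup, ?_, ?_, ?_⟩, ?_⟩, ?_, ?_⟩⟩
      · exact p.isChain_adj_support.imp fun _ _ h => h.1
      · rw [List.head?_eq_some_head p.support_ne_nil, SimpleGraph.Walk.head_support]
      · rw [List.getLast?_eq_some_getLast p.support_ne_nil, SimpleGraph.Walk.getLast_support]
      · rw [SimpleGraph.Walk.length_support]
        have : p.length ≠ 0 := fun h => huv (p.eq_of_length_eq_zero h)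
        omega
      · intro z hz
        obtain ⟨hz, hzu, hzv⟩ := mem_support_of_mem_internalVerts hp hz
        exact (hpA z hz).resolve_left (by simp [hzu, hzv])
      · rw [upathEdges_support, ← hn _ he, ← ZMod.intCast_eq_intCast_iff, ← hpw]
        exact (sum_map_edges _ _ _ _ hp.isTrail.edges_nodup).symm
  choose P hP using hroute
  refine ⟨φ, P, hφ, fun e he => (hP e he).1, ?_, ?_, fun e he => (hP e he).2.2⟩
  · rintro e he z hz ⟨u, rfl⟩
    exact (hA e ((hE e).mpr he) ((hP e he).2.1 _ hz)).2 (hφT u)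
  · intro e he f hf hef z hz hz'
    exact Set.disjoint_left.mp (hdisj e ((hE e).mpr he) f ((hE f).mpr hf) hef)
      ((hP e he).2.1 z hz) ((hP f hf).2.1 z hz')
end
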